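/- arXiv:1506.07773 — 4 statements merged into one kernel-verified Lean document; each statement's English description precedes it below -/
import Mathlib

section
/- Let G be a bipartite graph with bipartition {A,B}, let w assign a positive real weight to each vertex, and let k be a positive integer. Let S_A be a subset of A of cardinality min(k,|A|) of maximum total weight among all such subsets of A, and let S_B be a subset of B of cardinality min(k,|B|) of maximum total weight among all such subsets of B. Then every independent set O of G with |O| ≤ k satisfies w(O) ≤ w(S_A) + w(S_B) ≤ 2·max(w(S_A), w(S_B)). (This proves that the greedy algorithm returning the heavier of S_A and S_B is a 1/2-factor approximation for the Maximum Weighted Budgeted Independent Set problem on bipartite graphs.) -/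
/-- If `c` bounds the weight of every subset of `X` of cardinality `min k |X|`, then for
nonnegative weights it bounds the weight of every subset of `X` of cardinality at most `k`. -/
theorem sum_le_of_forall_card_eq_min_sum_le {V : Type*} {X U : Finset V} {w : V → ℝ} {k : ℕ}
    {c : ℝ} (hw : ∀ v ∈ X, 0 ≤ w v)
    (hc : ∀ T ⊆ X, T.card = min k X.card → ∑ v ∈ T, w v ≤ c)
    (hUX : U ⊆ X) (hU : U.card ≤ k) : ∑ v ∈ U, w v ≤ c := by
  obtain ⟨T, hUT, hTX, hT⟩ := Finset.exists_subsuperset_card_eq hUX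
    (le_min hU (Finset.card_le_card hUX)) (min_le_right k X.card)
  exact (Finset.sum_le_sum_of_subset_of_nonneg hUT fun v hv _ => hw v (hTX hv)).trans
    (hc T hTX hT)

/-- The greedy algorithm for MWBIS on bipartite graphs: any budgeted independent set weighs
at most `w(S_A) + w(S_B) ≤ 2 · max(w(S_A), w(S_B))`. -/
theorem mwbis_bipartite_half_approx {V : Type*} [Fintype V] [DecidableEq V]
    (G : SimpleGraph V) (A B : Finset V)
    (hpart : A ∪ B = Finset.univ) (hdisj : Disjoint A B)
    (hbip : ∀ u v : V, G.Adj u v → (u ∈ A ∧ v ∈ B) ∨ (u ∈ B ∧ v ∈ A))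
    (w : V → ℝ) (hw : ∀ v : V, 0 < w v) (k : ℕ) (hk : 0 < k)
    (SA SB : Finset V)
    (hSA : SA ⊆ A) (hSAcard : SA.card = min k A.card)
    (hSAmax : ∀ T ⊆ A, T.card = min k A.card → ∑ v ∈ T, w v ≤ ∑ v ∈ SA, w v)
    (hSB : SB ⊆ B) (hSBcard : SB.card = min k B.card)
    (hSBmax : ∀ T ⊆ B, T.card = min k B.card → ∑ v ∈ T, w v ≤ ∑ v ∈ SB, w v)
    (O : Finset V) (hOind : ∀ u ∈ O, ∀ v ∈ O, ¬ G.Adj u v) (hOcard : O.card ≤ k) :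
    (∑ v ∈ O, w v ≤ ∑ v ∈ SA, w v + ∑ v ∈ SB, w v) ∧
      (∑ v ∈ SA, w v + ∑ v ∈ SB, w v ≤ 2 * max (∑ v ∈ SA, w v) (∑ v ∈ SB, w v)) := by
  have hO : O = (O ∩ A) ∪ (O ∩ B) := by
    rw [← Finset.inter_union_distrib_left, hpart, Finset.inter_univ]
  have hOdisj : Disjoint (O ∩ A) (O ∩ B) :=
    hdisj.mono Finset.inter_subset_right Finset.inter_subset_right
  have hOA : ∑ v ∈ O ∩ A, w v ≤ ∑ v ∈ SA, w v :=
    sum_le_of_forall_card_eq_min_sum_le (fun v _ => (hw v).le) hSAmax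
      Finset.inter_subset_right ((Finset.card_le_card Finset.inter_subset_left).trans hOcard)
  have hOB : ∑ v ∈ O ∩ B, w v ≤ ∑ v ∈ SB, w v :=
    sum_le_of_forall_card_eq_min_sum_le (fun v _ => (hw v).le) hSBmax
      Finset.inter_subset_right ((Finset.card_le_card Finset.inter_subset_left).trans hOcard)
  constructor
  · rw [hO, Finset.sum_union hOdisj]
    exact add_le_add hOA hOB
  · rw [two_mul]
    exact add_le_add (le_max_left _ _) (le_max_right _ _)
end

section
/- Let G be a graph, let w assign a positive real weight to each vertex, let k be a positive integer, and let C_1, …, C_p be a partition of V(G) into p independent sets (i.e., a proper p-coloring). For each i ∈ [p], let S_i be a subset of C_i of cardinality min(k,|C_i|) of maximum total weight among all such subsets of C_i. Then every independent set O of G with |O| ≤ k satisfies w(O) ≤ p · max_{i ∈ [p]} w(S_i). (This proves that, given a proper p-coloring, the greedy algorithm returning the heaviest S_i is a 1/p-factor approximation for MWBIS.) -/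
/-- If `S` has maximum weight among the subsets of `C` of cardinality `min k #C`, then it is at
least as heavy as every subset of `C` of cardinality at most `k`, for nonnegative weights. -/
theorem Finset.sum_le_sum_of_maximal_card_eq_min {V : Type*} {C S A : Finset V} {w : V → ℝ}
    {k : ℕ} (hw : ∀ v, 0 ≤ w v)
    (hmax : ∀ T ⊆ C, T.card = min k C.card → ∑ v ∈ T, w v ≤ ∑ v ∈ S, w v)
    (hAC : A ⊆ C) (hA : A.card ≤ k) :
    ∑ v ∈ A, w v ≤ ∑ v ∈ S, w v := by
  obtain ⟨T, hAT, hTC, hT⟩ := Finset.exists_subsuperset_card_eq hAC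
    (le_min hA (Finset.card_le_card hAC)) (min_le_right k C.card)
  exact (Finset.sum_le_sum_of_subset_of_nonneg hAT fun v _ _ => hw v).trans (hmax T hTC hT)

/-- Given a proper `p`-coloring of `G`, the greedy algorithm returning the heaviest of the
per-color-class budgeted greedy sets is a `1/p`-factor approximation for MWBIS. -/
theorem mwbis_coloring_approx {V : Type*} [Fintype V] [DecidableEq V]
    (G : SimpleGraph V) (p : ℕ) (hp : 0 < p)
    (C : Fin p → Finset V)
    (hdisj : ∀ i j : Fin p, i ≠ j → Disjoint (C i) (C j))
    (hcover : Finset.univ.biUnion C = Finset.univ)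
    (hindep : ∀ i : Fin p, ∀ u ∈ C i, ∀ v ∈ C i, ¬ G.Adj u v)
    (w : V → ℝ) (hw : ∀ v : V, 0 < w v) (k : ℕ) (hk : 0 < k)
    (S : Fin p → Finset V)
    (hS : ∀ i, S i ⊆ C i) (hScard : ∀ i, (S i).card = min k (C i).card)
    (hSmax : ∀ i, ∀ T ⊆ C i, T.card = min k (C i).card →
      ∑ v ∈ T, w v ≤ ∑ v ∈ S i, w v)
    (O : Finset V) (hOind : ∀ u ∈ O, ∀ v ∈ O, ¬ G.Adj u v) (hOcard : O.card ≤ k) :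
    ∑ v ∈ O, w v ≤
      p * (Finset.univ.sup' (Finset.univ_nonempty_iff.mpr ⟨⟨0, hp⟩⟩)
        fun i : Fin p => ∑ v ∈ S i, w v) := by
  have hO : O = Finset.univ.biUnion fun i => O ∩ C i := by
    rw [← Finset.inter_biUnion, hcover, Finset.inter_univ]
  have hsum : ∑ v ∈ O, w v = ∑ i, ∑ v ∈ O ∩ C i, w v := by
    conv_lhs => rw [hO]
    exact Finset.sum_biUnion fun i _ j _ hij =>
      (hdisj i j hij).mono Finset.inter_subset_right Finset.inter_subset_right
  rw [hsum]
  refine (Finset.sum_le_card_nsmul _ _ _ fun i hi => ?_).trans_eq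
    (by rw [Finset.card_univ, Fintype.card_fin, nsmul_eq_mul])
  exact (Finset.sum_le_sum_of_maximal_card_eq_min (fun v => (hw v).le) (hSmax i)
    Finset.inter_subset_right
    ((Finset.card_le_card Finset.inter_subset_left).trans hOcard)).trans
    (Finset.le_sup' (fun i => ∑ v ∈ S i, w v) hi)
end

section
/- Let G be an r-regular simple graph on n vertices with m edges that contains no clique of size k, and for a positive integer j ≤ n define p_j(G) = max{ m − ||S|| : S ⊆ V(G), |S| = j }. Then for every integer i with 1 ≤ i ≤ r − k (and k + i ≤ n), p_{k+i}(G) ≤ p_{k+i−1}(G) − (r − (k + i − 2)). -/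
attribute [local instance] Classical.propDecidable

/-- A set of at least `k` vertices in a `k`-clique-free graph contains two distinct
non-adjacent vertices. -/
theorem SimpleGraph.CliqueFree.exists_not_adj {V : Type*} {G : SimpleGraph V} {k : ℕ}
    (hfree : G.CliqueFree k) {S : Finset V} (hS : k ≤ S.card) :
    ∃ v ∈ S, ∃ w ∈ S, v ≠ w ∧ ¬ G.Adj v w := by
  by_contra! h
  refine hfree.mono hS S ⟨fun v hv w hw hvw => h v hv w hw hvw, rfl⟩

/-- Removing `v` from `S` uncovers the edges joining `v` to vertices outside `S`. -/
theorem SimpleGraph.card_covered_erase_add_le {V : Type*} [Fintype V] [DecidableEq V]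
    (G : SimpleGraph V) {S : Finset V} {v : V} (hv : v ∈ S) :
    (G.edgeFinset.filter fun e => ∃ u ∈ S.erase v, u ∈ e).card
        + (G.neighborFinset v \ S).card
      ≤ (G.edgeFinset.filter fun e => ∃ u ∈ S, u ∈ e).card := by
  have hinj : Function.Injective fun u => s(v, u) := fun a b h => Sym2.congr_right.mp h
  rw [← Finset.card_image_of_injective (G.neighborFinset v \ S) hinj,
    ← Finset.card_union_of_disjoint]
  · refine Finset.card_le_card fun e he => ?_
    rcases Finset.mem_union.mp he with he | he
    · obtain ⟨he, u, hu, hue⟩ := Finset.mem_filter.mp he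
      exact Finset.mem_filter.mpr ⟨he, u, Finset.mem_of_mem_erase hu, hue⟩
    · obtain ⟨u, hu, rfl⟩ := Finset.mem_image.mp he
      rw [Finset.mem_sdiff, SimpleGraph.mem_neighborFinset] at hu
      exact Finset.mem_filter.mpr
        ⟨SimpleGraph.mem_edgeFinset.mpr hu.1, v, hv, Sym2.mem_mk_left v u⟩
  · rw [Finset.disjoint_left]
    intro e he he'
    obtain ⟨-, u, hu, hue⟩ := Finset.mem_filter.mp he
    obtain ⟨w, hw, rfl⟩ := Finset.mem_image.mp he'
    rw [Finset.mem_sdiff] at hw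
    rw [Finset.mem_erase] at hu
    rcases Sym2.mem_iff.mp hue with rfl | rfl
    · exact hu.1 rfl
    · exact hw.2 hu.2

/-- A vertex of `S` with a non-neighbour in `S` has at most `|S| - 2` neighbours in `S`. -/
theorem SimpleGraph.degree_add_two_le {V : Type*} [Fintype V] [DecidableEq V]
    (G : SimpleGraph V) {S : Finset V} {v w : V} (hv : v ∈ S) (hw : w ∈ S)
    (hvw : v ≠ w) (hadj : ¬ G.Adj v w) :
    G.degree v + 2 ≤ (G.neighborFinset v \ S).card + S.card := by
  have hsub : G.neighborFinset v ∩ S ⊆ (S.erase v).erase w := by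
    intro u hu
    rw [Finset.mem_inter, SimpleGraph.mem_neighborFinset] at hu
    refine Finset.mem_erase.mpr ⟨?_, Finset.mem_erase.mpr ⟨hu.1.ne', hu.2⟩⟩
    rintro rfl
    exact hadj hu.1
  have hle := Finset.card_le_card hsub
  have hv' := Finset.card_erase_add_one hv
  have hw' := Finset.card_erase_add_one (Finset.mem_erase.mpr ⟨hvw.symm, hw⟩)
  have hsplit := Finset.card_sdiff_add_card_inter (G.neighborFinset v) S
  rw [SimpleGraph.card_neighborFinset_eq_degree] at hsplit
  omega

/-- For an `r`-regular graph `G` with `m` edges and no `k`-clique, writing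
`p j = max { m − ‖S‖ : |S| = j }` (the maximum number of edges left uncovered by a `j`-set),
we have `p (k+i) ≤ p (k+i−1) − (r − (k+i−2))` for `1 ≤ i ≤ r − k`. -/
theorem uncovered_max_decreasing {V : Type*} [Fintype V] [DecidableEq V]
    (G : SimpleGraph V) (r n m k : ℕ) (hreg : G.IsRegularOfDegree r)
    (hn : Fintype.card V = n) (hm : G.edgeFinset.card = m)
    (hk : 0 < k) (hfree : G.CliqueFree k)
    (p : ℕ → ℕ)
    (hp : ∀ j : ℕ, p j = (Finset.univ.powersetCard j).sup
      fun S : Finset V => m - (G.edgeFinset.filter fun e => ∃ v ∈ S, v ∈ e).card)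
    (i : ℕ) (hi1 : 1 ≤ i) (hi2 : i ≤ r - k) (hin : k + i ≤ n) :
    (p (k + i) : ℤ) ≤ (p (k + i - 1) : ℤ) - ((r : ℤ) - ((k : ℤ) + (i : ℤ) - 2)) := by
  have hne : ((Finset.univ : Finset V).powersetCard (k + i)).Nonempty :=
    Finset.powersetCard_nonempty.mpr (by rw [Finset.card_univ, hn]; exact hin)
  obtain ⟨S, hS, hpS⟩ := Finset.exists_mem_eq_sup _ hne
    fun S : Finset V => m - (G.edgeFinset.filter fun e => ∃ v ∈ S, v ∈ e).card
  rw [← hp] at hpS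
  have hcard := (Finset.mem_powersetCard.mp hS).2
  obtain ⟨v, hv, w, hw, hvw, hadj⟩ := hfree.exists_not_adj (S := S) (by omega)
  have herase : S.erase v ∈ (Finset.univ : Finset V).powersetCard (k + i - 1) :=
    Finset.mem_powersetCard.mpr
      ⟨Finset.subset_univ _, by rw [Finset.card_erase_of_mem hv, hcard]⟩
  have hle := Finset.le_sup
    (f := fun S : Finset V => m - (G.edgeFinset.filter fun e => ∃ v ∈ S, v ∈ e).card) herase
  rw [← hp] at hle
  have hcov := G.card_covered_erase_add_le hv
  have hdeg := G.degree_add_two_le hv hw hvw hadj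
  have hr : G.degree v = r := by convert hreg v
  have hm' := Finset.card_filter_le G.edgeFinset fun e => ∃ v ∈ S, v ∈ e
  rw [hm] at hm'
  omega
end

section
/- Let n and k be integers with n > 11 and 1 ≤ k ≤ (n−1)/2, and set r = n − 4, m = n(n−4)/2, and x = m − (kr − k(k−1)/2). Then x ≥ (5/4)(n−k); in particular x > (7/6)(n−k), and consequently kr + x(r−1) > nr + k + x − n. -/
/-- For `n > 11`, `1 ≤ k ≤ (n−1)/2`, `r = n − 4`, `m = nr/2` and `x = m − (kr − k(k−1)/2)`,
we have `x ≥ (5/4)(n−k)`, hence `x > (7/6)(n−k)`, and consequently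
`kr + x(r−1) > nr + k + x − n`. -/
theorem construction_x_lower_bound (n k : ℕ) (hn : 11 < n) (hk : 1 ≤ k)
    (hkn : 2 * k ≤ n - 1)
    (r m x : ℚ) (hr : r = (n : ℚ) - 4) (hm : m = (n : ℚ) * r / 2)
    (hx : x = m - ((k : ℚ) * r - (k : ℚ) * ((k : ℚ) - 1) / 2)) :
    (5 / 4 : ℚ) * ((n : ℚ) - (k : ℚ)) ≤ x ∧
      (7 / 6 : ℚ) * ((n : ℚ) - (k : ℚ)) < x ∧
      (n : ℚ) * r + (k : ℚ) + x - (n : ℚ) < (k : ℚ) * r + x * (r - 1) := by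
  have hn' : (12 : ℚ) ≤ n := by exact_mod_cast hn
  have hk' : (1 : ℚ) ≤ k := by exact_mod_cast hk
  have hkn' : 2 * (k : ℚ) + 1 ≤ n := by
    have : 2 * k + 1 ≤ n := by omega
    exact_mod_cast this
  have hd : (13 / 2 : ℚ) ≤ (n : ℚ) - k := by linarith
  have hx' : x = (((n : ℚ) - k) ^ 2 - 4 * ((n : ℚ) - k) + 3 * k) / 2 := by
    rw [hx, hm, hr]; ring
  have h₁ : (5 / 4 : ℚ) * ((n : ℚ) - k) ≤ x := by
    rw [hx']
    nlinarith [mul_nonneg (by linarith : (0 : ℚ) ≤ (n : ℚ) - k) (sub_nonneg.2 hd)]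
  have h₂ : (7 / 6 : ℚ) * ((n : ℚ) - k) < x := by linarith
  refine ⟨h₁, h₂, ?_⟩
  have hr₈ : 8 ≤ r := by linarith
  have hmul := mul_pos (sub_pos.2 h₂) (by linarith : 0 < r - 2)
  have hdr := mul_nonneg (by linarith : (0 : ℚ) ≤ (n : ℚ) - k) (sub_nonneg.2 hr₈)
  linarith
end
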